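/- arXiv:1912.01188 — 2 statements merged into one kernel-verified Lean document; each statement's English description precedes it below -/
import Mathlib

section
/- Suppose the H-horizon planner prefers the suboptimal trajectory, i.e. ∑_{k=0}^{H-1} γ^k r*_k + γ^H V̂* ≤ ∑_{k=0}^{H-1} γ^k r_k + γ^H V̂ (hypothesis (i)); the terminal value estimates are accurate at both terminal states: |V̂* − Vπ*| ≤ ε_V and |V̂ − Vπ| ≤ ε_V (hypothesis (ii)); and the future agent policy suboptimality is bounded at the optimal terminal state: V* − Vπ* ≤ ε_P (hypothesis (iii)). Then the long-term regret LR = V* − Vπ satisfies LR ≤ 2·R_max·(1 − γ^H)/(γ^H·(1 − γ)) + 2·ε_V + ε_P. -/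
/-- Lemma 1 (long-term regret bound, exact form with `1 - γ^H` factor):
if the `H`-horizon planner prefers the suboptimal trajectory, the terminal value
estimates are `ε_V`-accurate at both terminal states, and the future agent policy
suboptimality at the optimal terminal state is at most `ε_P`, then the long-term
regret `V* − Vπ` is at most `2 R_max (1 − γ^H) / (γ^H (1 − γ)) + 2 ε_V + ε_P`. -/
theorem long_term_regret_bound
    (γ Rmax εV εP : ℝ) (H : ℕ)
    (hγ0 : 0 < γ) (hγ1 : γ < 1) (hR : 0 ≤ Rmax) (hH : 1 ≤ H)
    (hεV : 0 ≤ εV) (hεP : 0 ≤ εP)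
    (rstar r : ℕ → ℝ)
    (hrstar : ∀ k < H, -Rmax ≤ rstar k ∧ rstar k ≤ Rmax)
    (hr : ∀ k < H, -Rmax ≤ r k ∧ r k ≤ Rmax)
    (Vhatstar Vhat Vpistar Vpi Vstar : ℝ)
    (hplan : ∑ k ∈ Finset.range H, γ ^ k * rstar k + γ ^ H * Vhatstar ≤
             ∑ k ∈ Finset.range H, γ ^ k * r k + γ ^ H * Vhat)
    (hVstarerr : |Vhatstar - Vpistar| ≤ εV)
    (hVerr : |Vhat - Vpi| ≤ εV)
    (hpol : Vstar - Vpistar ≤ εP) :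
    Vstar - Vpi ≤ 2 * Rmax * (1 - γ ^ H) / (γ ^ H * (1 - γ)) + 2 * εV + εP := by
  have hsum : ∑ k ∈ Finset.range H, γ ^ k * r k - ∑ k ∈ Finset.range H, γ ^ k * rstar k ≤
      2 * Rmax * ∑ k ∈ Finset.range H, γ ^ k := by
    rw [← Finset.sum_sub_distrib, Finset.mul_sum]
    refine Finset.sum_le_sum fun k hk => ?_
    have hk' := Finset.mem_range.mp hk
    have hdiff : r k - rstar k ≤ 2 * Rmax := by linarith [(hrstar k hk').1, (hr k hk').2]
    linarith [mul_le_mul_of_nonneg_left hdiff (pow_nonneg hγ0.le k)]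
  have hVhat : Vhatstar - Vhat ≤ 2 * Rmax * (1 - γ ^ H) / (γ ^ H * (1 - γ)) := by
    have h1γ : 0 < 1 - γ := sub_pos.mpr hγ1
    rw [le_div_iff₀ (mul_pos (pow_pos hγ0 H) h1γ), ← mul_neg_geom_sum γ H]
    have hscaled : γ ^ H * (Vhatstar - Vhat) ≤ 2 * Rmax * ∑ k ∈ Finset.range H, γ ^ k := by
      linarith
    linarith [mul_le_mul_of_nonneg_left hscaled h1γ.le]
  linarith [(abs_le.mp hVstarerr).1, (abs_le.mp hVerr).2]
end

section
/- Suppose the H-horizon planner prefers the suboptimal trajectory, i.e. ∑_{k=0}^{H-1} γ^k r*_k + γ^H V̂* ≤ ∑_{k=0}^{H-1} γ^k r_k + γ^H V̂; the terminal value estimates are accurate at both terminal states: |V̂* − Vπ*| ≤ ε_V and |V̂ − Vπ| ≤ ε_V; and the future agent policy suboptimality is bounded at the optimal terminal state: V* − Vπ* ≤ ε_P. Then the long-term regret LR = V* − Vπ satisfies the (coarser) bound LR ≤ 2·R_max/(γ^H·(1 − γ)) + 2·ε_V + ε_P. -/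
/-- The discounted sums of two reward sequences bounded by `R` differ by at most
`2 R / (1 - γ)`. -/
theorem sum_pow_mul_sub_sum_pow_mul_le {γ R : ℝ} {H : ℕ} (hγ0 : 0 ≤ γ) (hγ1 : γ < 1)
    (hR : 0 ≤ R) {a b : ℕ → ℝ} (ha : ∀ k < H, a k ≤ R) (hb : ∀ k < H, -R ≤ b k) :
    ∑ k ∈ Finset.range H, γ ^ k * a k - ∑ k ∈ Finset.range H, γ ^ k * b k
      ≤ 2 * R / (1 - γ) := by
  have hgeom : ∑ k ∈ Finset.range H, γ ^ k ≤ (1 - γ)⁻¹ := by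
    rw [← tsum_geometric_of_lt_one hγ0 hγ1]
    exact (summable_geometric_of_lt_one hγ0 hγ1).sum_le_tsum _ fun k _ => pow_nonneg hγ0 k
  calc ∑ k ∈ Finset.range H, γ ^ k * a k - ∑ k ∈ Finset.range H, γ ^ k * b k
      = ∑ k ∈ Finset.range H, γ ^ k * (a k - b k) := by
        simp only [mul_sub, Finset.sum_sub_distrib]
    _ ≤ ∑ k ∈ Finset.range H, γ ^ k * (2 * R) := by
        refine Finset.sum_le_sum fun k hk => mul_le_mul_of_nonneg_left ?_ (pow_nonneg hγ0 k)
        have hk := Finset.mem_range.mp hk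
        linarith [ha k hk, hb k hk]
    _ = 2 * R * ∑ k ∈ Finset.range H, γ ^ k := by rw [← Finset.sum_mul, mul_comm]
    _ ≤ 2 * R / (1 - γ) := by
        rw [div_eq_mul_inv]
        exact mul_le_mul_of_nonneg_left hgeom (by positivity)

/-- Lemma 1 (long-term regret bound, coarser form as stated in the paper):
under the same hypotheses, the long-term regret `V* − Vπ` is at most
`2 R_max / (γ^H (1 − γ)) + 2 ε_V + ε_P`. -/
theorem long_term_regret_bound_coarse
    (γ Rmax εV εP : ℝ) (H : ℕ)
    (hγ0 : 0 < γ) (hγ1 : γ < 1) (hR : 0 ≤ Rmax) (hH : 1 ≤ H)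
    (hεV : 0 ≤ εV) (hεP : 0 ≤ εP)
    (rstar r : ℕ → ℝ)
    (hrstar : ∀ k < H, -Rmax ≤ rstar k ∧ rstar k ≤ Rmax)
    (hr : ∀ k < H, -Rmax ≤ r k ∧ r k ≤ Rmax)
    (Vhatstar Vhat Vpistar Vpi Vstar : ℝ)
    (hplan : ∑ k ∈ Finset.range H, γ ^ k * rstar k + γ ^ H * Vhatstar ≤
             ∑ k ∈ Finset.range H, γ ^ k * r k + γ ^ H * Vhat)
    (hVstarerr : |Vhatstar - Vpistar| ≤ εV)
    (hVerr : |Vhat - Vpi| ≤ εV)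
    (hpol : Vstar - Vpistar ≤ εP) :
    Vstar - Vpi ≤ 2 * Rmax / (γ ^ H * (1 - γ)) + 2 * εV + εP := by
  have hrewards := sum_pow_mul_sub_sum_pow_mul_le hγ0.le hγ1 hR
    (fun k hk => (hr k hk).2) (fun k hk => (hrstar k hk).1)
  have hestimates : Vhatstar - Vhat ≤ 2 * Rmax / (γ ^ H * (1 - γ)) := by
    rw [mul_comm (γ ^ H), ← div_div, le_div_iff₀ (pow_pos hγ0 H)]
    linarith
  linarith [(abs_le.mp hVstarerr).1, (abs_le.mp hVerr).2]
end
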